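/- For every d ≥ 0 and every x ∈ {0,1}^(4^d), the average choice complexity for Player B equals the effective resistance of the associated dual-family graph: C_B(x) = R_{s',t'}(G'_d(x)); in particular both sides are ∞ exactly when x is a 1-instance. -/

import Mathlib

open scoped ENNReal
open scoped Classical

namespace NandTree

/-- The bit-`b` half of an input of length `2^(m+1)`: `b = false` gives the first half,
`b = true` the second half (lexicographic indexing, first bit most significant). -/
def halfInput (m : ℕ) (b : Bool) (x : Fin (2^(m+1)) → Bool) : Fin (2^m) → Bool :=
  fun i => x ⟨(cond b 1 0) * 2^m + i.val, by
    have h := i.isLt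
    have h2 : (2:ℕ)^(m+1) = 2^m * 2 := pow_succ 2 m
    cases b <;> simp only [cond_true, cond_false] <;> omega⟩

/-- The value `NAND_ℓ(x)` of a depth-`ℓ` NAND-tree instance: internal nodes at even
distance from the leaves are OR gates, at odd distance AND gates. -/
def nand : (ℓ : ℕ) → (Fin (2^ℓ) → Bool) → Bool
  | 0, x => x ⟨0, by norm_num⟩
  | (ℓ+1), x =>
    if (ℓ+1) % 2 = 0 then
      nand ℓ (halfInput ℓ false x) || nand ℓ (halfInput ℓ true x)
    else
      nand ℓ (halfInput ℓ false x) && nand ℓ (halfInput ℓ true x)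

/-- Index of a leaf given by a root-to-leaf bit string (lexicographic, first bit most
significant). -/
def leafIdx (s : List Bool) : ℕ := s.foldl (fun n b => 2 * n + cond b 1 0) 0

/-- The value of the leaf reached by bit string `s` in instance `x`. -/
def leafVal (m : ℕ) (x : Fin (2^m) → Bool) (s : List Bool) : Bool :=
  if h : leafIdx s < 2^m then x ⟨leafIdx s, h⟩ else false

/-- The root-to-leaf path determined by strategies `σA`, `σB` (each assigning a choice of
child to every node, nodes being given by the list of choices from the root): at a node
at distance `m+1` from the leaves, Player A chooses a child if `m+1` is even, else
Player B chooses. -/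
def gamePath (σA σB : List Bool → Bool) : (m : ℕ) → List Bool → List Bool
  | 0, p => p
  | (m+1), p => gamePath σA σB m (p ++ [if (m+1) % 2 = 0 then σA p else σB p])

/-- `winning Z m x σ`: strategy `σ` is a winning strategy for player `Z` (`true` = A,
`false` = B) in the two-player game on the depth-`m` instance `x`: against every
opponent strategy, the reached leaf has value `Z` (A wins on `1 = true`, B on
`0 = false`). -/
def winning (Z : Bool) (m : ℕ) (x : Fin (2^m) → Bool) (σ : List Bool → Bool) : Prop :=
  ∀ τ : List Bool → Bool,
    leafVal m x (gamePath (if Z then σ else τ) (if Z then τ else σ) m []) = Z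

mutual

/-- The criticality `c(v)` of the root of a depth-`m` subtree with input `y`. -/
noncomputable def crit : (m : ℕ) → (Fin (2^m) → Bool) → ℝ≥0∞
  | 0, _ => 1
  | 1, y => if y ⟨0, by norm_num⟩ = y ⟨1, by norm_num⟩ then 1 else 2
  | (m+2), y =>
    if nand (m+2) y ≠ decide ((m+2) % 2 = 0) then 1
    else if nand (m+1) (halfInput (m+1) false y) ≠ nand (m+1) (halfInput (m+1) true y) then 2
    else
      (max (CZ (decide ((m+2) % 2 = 0)) m (halfInput m false (halfInput (m+1) false y)) +
            CZ (decide ((m+2) % 2 = 0)) m (halfInput m true (halfInput (m+1) false y)))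
           (CZ (decide ((m+2) % 2 = 0)) m (halfInput m false (halfInput (m+1) true y)) +
            CZ (decide ((m+2) % 2 = 0)) m (halfInput m true (halfInput (m+1) true y)))) /
      (((CZ (decide ((m+2) % 2 = 0)) m (halfInput m false (halfInput (m+1) false y)) +
         CZ (decide ((m+2) % 2 = 0)) m (halfInput m true (halfInput (m+1) false y))) +
        ((CZ (decide ((m+2) % 2 = 0)) m (halfInput m false (halfInput (m+1) true y)) +
          CZ (decide ((m+2) % 2 = 0)) m (halfInput m true (halfInput (m+1) true y))))) / 2)
termination_by m _ => (m, 0)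

/-- The expected product, over the random choices of `Z`'s opponent, of the criticalities
of the nodes at which `Z` moves along the path played according to strategy `σ`. -/
noncomputable def pathProd (Z : Bool) :
    (σ : List Bool → Bool) → (m : ℕ) → (Fin (2^m) → Bool) → ℝ≥0∞
  | _, 0, _ => 1
  | σ, (m+1), y =>
    if decide ((m+1) % 2 = 0) = Z then
      crit (m+1) y * pathProd Z (fun q => σ (σ [] :: q)) m (halfInput m (σ []) y)
    else
      (pathProd Z (fun q => σ (false :: q)) m (halfInput m false y) +
       pathProd Z (fun q => σ (true :: q)) m (halfInput m true y)) / 2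
termination_by _ m _ => (m, 1)

/-- The average choice complexity `C_Z` of a depth-`m` instance `y` for player `Z`
(`true` = A, `false` = B): the infimum, over `Z`-winning strategies, of the expected
product of criticalities over the nodes where `Z` moves (and `∞` if `Z` has no winning
strategy, the infimum over the empty set being `⊤`). -/
noncomputable def CZ (Z : Bool) (m : ℕ) (y : Fin (2^m) → Bool) : ℝ≥0∞ :=
  ⨅ σ ∈ {σ : List Bool → Bool | winning Z m y σ}, pathProd Z σ m y
termination_by (m, 2)

end

/-- Edges of the multigraph `G'_d`: `G'_0` has a single edge; each edge `e` of `G'_d` is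
replaced by four edges `(e, c, b)` in `G'_{d+1}`, where `c` selects the side (`false`:
between `u'` and the middle vertex, `true`: between the middle vertex and `v'`) and `b`
selects one of the two parallel edges on that side. -/
def Edg' : ℕ → Type
  | 0 => Unit
  | (d+1) => Edg' d × Bool × Bool

/-- Vertices of `G'_d`: `G'_0` has vertices `s' = false`, `t' = true`; `G'_{d+1}` has the
vertices of `G'_d` plus one new middle vertex for each edge of `G'_d`. -/
def Vtx' : ℕ → Type
  | 0 => Bool
  | (d+1) => Vtx' d ⊕ Edg' d

instance edg'Fintype : (d : ℕ) → Fintype (Edg' d)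
  | 0 => inferInstanceAs (Fintype Unit)
  | (d+1) => letI := edg'Fintype d; inferInstanceAs (Fintype (Edg' d × Bool × Bool))

instance edg'DecEq : (d : ℕ) → DecidableEq (Edg' d)
  | 0 => inferInstanceAs (DecidableEq Unit)
  | (d+1) => letI := edg'DecEq d; inferInstanceAs (DecidableEq (Edg' d × Bool × Bool))

instance vtx'DecEq : (d : ℕ) → DecidableEq (Vtx' d)
  | 0 => inferInstanceAs (DecidableEq Bool)
  | (d+1) => letI := edg'DecEq d; letI := vtx'DecEq d
             inferInstanceAs (DecidableEq (Vtx' d ⊕ Edg' d))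

/-- The two endpoints of an edge of `G'_d`. -/
def ep' : (d : ℕ) → Edg' d → Bool → Vtx' d
  | 0, _, k => k
  | (d+1), (e, c, _b), k =>
    match c, k with
    | false, false => Sum.inl (ep' d e false)
    | false, true  => Sum.inr e
    | true,  false => Sum.inr e
    | true,  true  => Sum.inl (ep' d e true)

/-- The vertex `s'` of `G'_d`. -/
def sVtx' : (d : ℕ) → Vtx' d
  | 0 => false
  | (d+1) => Sum.inl (sVtx' d)

/-- The vertex `t'` of `G'_d`. -/
def tVtx' : (d : ℕ) → Vtx' d
  | 0 => true
  | (d+1) => Sum.inl (tVtx' d)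

/-- The label of an edge of `G'_d`: the edge of `G'_0` is labeled by the empty string,
and the four edges replacing an edge labeled `τ` are labeled `τ00`, `τ01` (the two
parallel edges between `u'` and the middle vertex) and `τ10`, `τ11` (the two parallel
edges between the middle vertex and `v'`). -/
def elabel' : (d : ℕ) → Edg' d → List Bool
  | 0, _ => []
  | (d+1), (e, c, b) => elabel' d e ++ [c, b]

/-- The input bit of `x` associated with edge `e` of `G'_d`. -/
def edgeBit' (d : ℕ) (x : Fin (2^(2*d)) → Bool) (e : Edg' d) : Bool :=
  leafVal (2*d) x (elabel' d e)

/-- Two vertices are adjacent via a kept edge. -/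
def adjE {V E : Type} (epf : E → Bool → V) (keep : E → Prop) (u v : V) : Prop :=
  ∃ e, keep e ∧ ((epf e false = u ∧ epf e true = v) ∨ (epf e false = v ∧ epf e true = u))

/-- `a` and `b` are connected in the (multi)graph with endpoint map `epf`, restricted to
the edges satisfying `keep`. -/
def ConnectedIn {V E : Type} (epf : E → Bool → V) (keep : E → Prop) (a b : V) : Prop :=
  Relation.ReflTransGen (adjE epf keep) a b

/-- The net flow of `θ` out of vertex `v` (each edge oriented from its `false` endpoint
to its `true` endpoint; a function on oriented edges with `θ(rev e) = -θ(e)` is the same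
data as a function on these chosen orientations). -/
noncomputable def netFlow {V E : Type} [Fintype E] (epf : E → Bool → V) (θ : E → ℝ)
    (v : V) : ℝ :=
  ∑ e, θ e * ((if epf e false = v then (1:ℝ) else 0) - (if epf e true = v then 1 else 0))

/-- `θ` is a unit `s`-`t` flow supported on the kept edges: it vanishes on discarded
edges, has net outflow `1` at `s`, net inflow `1` at `t`, and zero net flow elsewhere. -/
def IsUnitFlow {V E : Type} [Fintype E] (epf : E → Bool → V) (keep : E → Prop)
    (s t : V) (θ : E → ℝ) : Prop :=
  (∀ e, ¬ keep e → θ e = 0) ∧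
  (∀ v, netFlow epf θ v = (if v = s then (1:ℝ) else 0) - (if v = t then 1 else 0))

/-- The effective resistance between `s` and `t` in the (multi)graph given by the edges
satisfying `keep`: the least energy of a unit `s`-`t` flow if `s` and `t` are connected,
and `∞` otherwise. -/
noncomputable def effRes {V E : Type} [Fintype E] (epf : E → Bool → V) (keep : E → Prop)
    (s t : V) : ℝ≥0∞ :=
  if ConnectedIn epf keep s t then
    ⨅ θ ∈ {θ : E → ℝ | IsUnitFlow epf keep s t θ}, ENNReal.ofReal (∑ e, (θ e)^2)
  else ⊤

/-! ### Game-tree side -/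

lemma gamePath_cons (σA σB : List Bool → Bool) (m : ℕ) (b : Bool) (p : List Bool) :
    gamePath σA σB m (b :: p)
      = b :: gamePath (fun q => σA (b :: q)) (fun q => σB (b :: q)) m p := by
  induction m generalizing p with
  | zero => rfl
  | succ m ih =>
    simp only [gamePath]
    rw [List.cons_append, ih]

lemma gamePath_length (σA σB : List Bool → Bool) (m : ℕ) (p : List Bool) :
    (gamePath σA σB m p).length = p.length + m := by
  induction m generalizing p with
  | zero => rfl
  | succ m ih =>
    simp only [gamePath]
    rw [ih]
    simp
    omega

lemma foldl_idx (s : List Bool) (n : ℕ) :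
    s.foldl (fun n b => 2 * n + cond b 1 0) n = n * 2 ^ s.length + leafIdx s := by
  induction s generalizing n with
  | nil => simp [leafIdx]
  | cons b s ih =>
    simp only [List.foldl_cons, leafIdx, List.length_cons]
    rw [ih, ih (2 * 0 + _)]
    ring

lemma leafIdx_cons (b : Bool) (s : List Bool) :
    leafIdx (b :: s) = cond b 1 0 * 2 ^ s.length + leafIdx s := by
  conv_lhs => unfold leafIdx
  rw [List.foldl_cons, foldl_idx]
  simp

lemma leafIdx_lt (s : List Bool) : leafIdx s < 2 ^ s.length := by
  induction s with
  | nil => simp [leafIdx]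
  | cons b s ih =>
    rw [leafIdx_cons, List.length_cons, pow_succ]
    cases b <;> simp only [cond_true, cond_false] <;> omega

lemma leafVal_cons (m : ℕ) (x : Fin (2^(m+1)) → Bool) (b : Bool) (s : List Bool)
    (hs : s.length = m) : leafVal (m+1) x (b :: s) = leafVal m (halfInput m b x) s := by
  have h1 : leafIdx s < 2 ^ m := hs ▸ leafIdx_lt s
  have h2 : leafIdx (b :: s) < 2 ^ (m+1) := by
    have := leafIdx_lt (b :: s)
    simpa [hs] using this
  unfold leafVal
  rw [dif_pos h1, dif_pos h2]
  unfold halfInput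
  congr 1
  apply Fin.ext
  simp [leafIdx_cons, hs]

lemma winning_odd (m : ℕ) (hm : (m+1) % 2 ≠ 0) (x : Fin (2^(m+1)) → Bool)
    (σ : List Bool → Bool) :
    winning false (m+1) x σ ↔
      winning false m (halfInput m (σ []) x) (fun q => σ (σ [] :: q)) := by
  unfold winning
  simp only [gamePath, hm, if_false, List.nil_append, Bool.false_eq_true, gamePath_cons]
  constructor
  · intro h τ
    have := h (fun q => τ q.tail)
    rw [leafVal_cons _ _ _ _ (by rw [gamePath_length]; simp)] at this
    simpa using this
  · intro h τ
    rw [leafVal_cons _ _ _ _ (by rw [gamePath_length]; simp)]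
    exact h _

lemma winning_even (m : ℕ) (hm : (m+1) % 2 = 0) (x : Fin (2^(m+1)) → Bool)
    (σ : List Bool → Bool) :
    winning false (m+1) x σ ↔
      ∀ b, winning false m (halfInput m b x) (fun q => σ (b :: q)) := by
  unfold winning
  simp only [gamePath, hm, if_true, if_false, List.nil_append, Bool.false_eq_true, gamePath_cons]
  constructor
  · intro h b τ
    have := h (fun q => if q = [] then b else τ q.tail)
    rw [leafVal_cons _ _ _ _ (by rw [gamePath_length]; simp)] at this
    simpa using this
  · intro h τ
    rw [leafVal_cons _ _ _ _ (by rw [gamePath_length]; simp)]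
    exact h _ _

/-- glue two strategies -/
def glue (σ0 σ1 : List Bool → Bool) (c : Bool) : List Bool → Bool
  | [] => c
  | (false :: q) => σ0 q
  | (true :: q) => σ1 q

lemma CZ_even (m : ℕ) (hm : (m+1) % 2 = 0) (x : Fin (2^(m+1)) → Bool) :
    CZ false (m+1) x = (CZ false m (halfInput m false x) + CZ false m (halfInput m true x)) / 2 := by
  have key : ∀ σ, pathProd false σ (m+1) x =
      (pathProd false (fun q => σ (false :: q)) m (halfInput m false x) +
       pathProd false (fun q => σ (true :: q)) m (halfInput m true x)) / 2 := by
    intro σ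
    rw [pathProd]
    simp [hm]
  apply le_antisymm
  · rw [ENNReal.le_div_iff_mul_le (by simp) (by simp)]
    rw [CZ.eq_def false m, CZ.eq_def false m]
    simp only [ENNReal.iInf_add, ENNReal.add_iInf]
    refine le_iInf fun σ1 => le_iInf fun h1 => le_iInf fun σ0 => le_iInf fun h0 => ?_
    rw [← ENNReal.le_div_iff_mul_le (by simp) (by simp)]
    rw [CZ]
    refine (iInf₂_le (glue σ0 σ1 false) ?_).trans ?_
    · refine (winning_even m hm x _).2 ?_
      intro b
      cases b
      · exact h0
      · exact h1
    · rw [key]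
      exact le_rfl
  · rw [CZ.eq_def false (m+1)]
    refine le_iInf₂ fun σ hσ => ?_
    rw [key]
    have hw := (winning_even m hm x σ).1 hσ
    gcongr
    · rw [CZ]
      exact iInf₂_le _ (hw false)
    · rw [CZ]
      exact iInf₂_le _ (hw true)

lemma CZ_odd (m : ℕ) (hm : (m+1) % 2 ≠ 0) (x : Fin (2^(m+1)) → Bool)
    (h0 : crit (m+1) x ≠ 0) (ht : crit (m+1) x ≠ ⊤) :
    CZ false (m+1) x =
      crit (m+1) x * min (CZ false m (halfInput m false x)) (CZ false m (halfInput m true x)) := by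
  have key : ∀ σ, pathProd false σ (m+1) x =
      crit (m+1) x * pathProd false (fun q => σ (σ [] :: q)) m (halfInput m (σ []) x) := by
    intro σ
    rw [pathProd]
    simp [hm]
  have hle : ∀ b, CZ false (m+1) x ≤ crit (m+1) x * CZ false m (halfInput m b x) := by
    intro b
    rw [CZ.eq_def false m]
    simp only [ENNReal.mul_iInf_of_ne h0 ht]
    refine le_iInf₂ fun σ hσ => ?_
    rw [CZ]
    refine (iInf₂_le (glue σ σ b) ?_).trans ?_
    · refine (winning_odd m hm x _).2 ?_
      cases b <;> exact hσ
    · rw [key]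
      cases b <;> exact le_rfl
  apply le_antisymm
  · rcases min_choice (CZ false m (halfInput m false x)) (CZ false m (halfInput m true x)) with h | h
    · rw [h]; exact hle _
    · rw [h]; exact hle _
  · rw [CZ.eq_def false (m+1)]
    refine le_iInf₂ fun σ hσ => ?_
    rw [key]
    have hw := (winning_odd m hm x σ).1 hσ
    gcongr
    have : CZ false m (halfInput m (σ []) x) ≤
        pathProd false (fun q => σ (σ [] :: q)) m (halfInput m (σ []) x) := by
      rw [CZ]
      exact iInf₂_le _ hw
    refine le_trans ?_ this
    cases σ []
    · exact min_le_left _ _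
    · exact min_le_right _ _

/-- parallel composition of resistances -/
noncomputable def par (a b : ℝ≥0∞) : ℝ≥0∞ := (a⁻¹ + b⁻¹)⁻¹

lemma par_fin (a b : ℝ≥0∞) (ha : a ≠ ⊤) (hb : b ≠ ⊤) (ha0 : a ≠ 0) (hb0 : b ≠ 0) :
    (max a b / ((a + b)/2)) * min a b = 2 * par a b := by
  have h : max a b * min a b = a * b := max_mul_min a b
  unfold par
  rw [ENNReal.div_eq_inv_mul, mul_assoc, h]
  lift a to NNReal using ha
  lift b to NNReal using hb
  have ha' : a ≠ 0 := by simpa using ha0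
  have hb' : b ≠ 0 := by simpa using hb0
  rw [← ENNReal.coe_inv ha', ← ENNReal.coe_inv hb', ← ENNReal.coe_add, ← ENNReal.coe_add,
    ← ENNReal.coe_inv (by positivity)]
  rw [show ((2:ℝ≥0∞)) = ((2:NNReal):ℝ≥0∞) from rfl, ← ENNReal.coe_div (by norm_num),
    ← ENNReal.coe_inv (by positivity)]
  norm_cast
  field_simp
  rw [add_comm]

lemma par_top_left (b : ℝ≥0∞) : par ⊤ b = b := by simp [par]
lemma par_top_right (b : ℝ≥0∞) : par b ⊤ = b := by simp [par]

lemma par_eq_top (a b : ℝ≥0∞) : par a b = ⊤ ↔ a = ⊤ ∧ b = ⊤ := by simp [par]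

/-- invariant on complexities of even-depth instances -/
def Inv (m : ℕ) : Prop := ∀ y : Fin (2^m) → Bool,
  CZ false m y ≠ 0 ∧ (CZ false m y = ⊤ ↔ nand m y = true)

lemma CZ_zero (y : Fin (2^0) → Bool) :
    CZ false 0 y = if y ⟨0, by norm_num⟩ = true then ⊤ else 1 := by
  rw [CZ]
  have : ∀ σ, winning false 0 y σ ↔ y ⟨0, by norm_num⟩ = false := by
    intro σ
    simp [winning, gamePath, leafVal, leafIdx]
  simp only [Set.mem_ofPred_eq, this, pathProd]
  generalize y ⟨0, by norm_num⟩ = z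
  cases z <;> simp

lemma inv_zero : Inv 0 := by
  intro y
  rw [CZ_zero, nand]
  generalize y ⟨0, by norm_num⟩ = z
  cases z <;> simp

lemma crit_spec (d : ℕ) (h : Inv (2*d)) (y : Fin (2^(2*d+1)) → Bool) :
    crit (2*d+1) y ≠ 0 ∧ crit (2*d+1) y ≠ ⊤ ∧
    crit (2*d+1) y * min (CZ false (2*d) (halfInput (2*d) false y))
        (CZ false (2*d) (halfInput (2*d) true y))
      = 2 * par (CZ false (2*d) (halfInput (2*d) false y))
        (CZ false (2*d) (halfInput (2*d) true y)) := by
  cases d with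
  | zero =>
    rw [CZ_zero, CZ_zero]
    have e0 : halfInput 0 false y ⟨0, by norm_num⟩ = y ⟨0, by norm_num⟩ := rfl
    have e1 : halfInput 0 true y ⟨0, by norm_num⟩ = y ⟨1, by norm_num⟩ := rfl
    rw [e0, e1]
    have hc : crit (2*0+1) y = if y ⟨0, by norm_num⟩ = y ⟨1, by norm_num⟩ then 1 else 2 := by
      change crit 1 y = _
      rw [crit]
    rw [hc]
    generalize y ⟨0, by norm_num⟩ = z0
    generalize y ⟨1, by norm_num⟩ = z1
    cases z0 <;> cases z1 <;> simp [par]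
    rw [one_add_one_eq_two, ENNReal.mul_inv_cancel] <;> simp
  | succ d =>
    obtain ⟨p0, t0⟩ := h (halfInput (2*(d+1)) false y)
    obtain ⟨p1, t1⟩ := h (halfInput (2*(d+1)) true y)
    have ev := fun x => CZ_even (2*d+1) (by omega) x
    have dbl : ∀ b, CZ false (2*d+1) (halfInput (2*d+1) false (halfInput (2*d+1+1) b y)) +
            CZ false (2*d+1) (halfInput (2*d+1) true (halfInput (2*d+1+1) b y))
          = 2 * CZ false (2*(d+1)) (halfInput (2*(d+1)) b y) := by
      intro b
      have := ev (halfInput (2*d+1+1) b y)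
      change _ = 2 * CZ false (2*d+1+1) (halfInput (2*d+1+1) b y)
      rw [this, ENNReal.mul_div_cancel] <;> simp
    have hodd : ¬ ((2*d+1+2) % 2 = 0) := by omega
    have hcrit : crit (2*(d+1)+1) y = 
      if nand (2*d+1+2) y = true then 1
      else if nand (2*(d+1)) (halfInput (2*(d+1)) false y) ≠ nand (2*(d+1)) (halfInput (2*(d+1)) true y) then 2
      else (max (CZ false (2*(d+1)) (halfInput (2*(d+1)) false y)) (CZ false (2*(d+1)) (halfInput (2*(d+1)) true y))) / ((CZ false (2*(d+1)) (halfInput (2*(d+1)) false y) + CZ false (2*(d+1)) (halfInput (2*(d+1)) true y))/2) := by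
      change crit (2*d+1+2) y = _
      rw [crit]
      simp only [hodd, decide_false, dbl]
      have e : max (2 * CZ false (2*(d+1)) (halfInput (2*(d+1)) false y)) (2 * CZ false (2*(d+1)) (halfInput (2*(d+1)) true y)) = 2 * max (CZ false (2*(d+1)) (halfInput (2*(d+1)) false y)) (CZ false (2*(d+1)) (halfInput (2*(d+1)) true y)) := by
        rw [mul_max]
      rw [e, ← mul_add, mul_div_assoc 2 (_ + _) 2, ENNReal.mul_div_mul_left _ _ (by simp) (by simp)]
      simp only [ne_eq, Bool.not_eq_false]
      rfl
    have hn : nand (2*d+1+2) y = (nand (2*(d+1)) (halfInput (2*(d+1)) false y) && nand (2*(d+1)) (halfInput (2*(d+1)) true y)) := by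
      rw [nand]
      rw [if_neg (by omega)]
      rfl
    rw [hcrit, hn]
    generalize CZ false (2*(d+1)) (halfInput (2*(d+1)) false y) = a at *
    generalize CZ false (2*(d+1)) (halfInput (2*(d+1)) true y) = b at *
    cases ha : nand (2*(d+1)) (halfInput (2*(d+1)) false y) <;>
    cases hb : nand (2*(d+1)) (halfInput (2*(d+1)) true y) <;> 
    simp only [ha, hb, Bool.false_eq_true, iff_false, iff_true] at t0 t1
    · simp only [Bool.and_false, Bool.false_eq_true, if_false, ne_eq, not_true_eq_false]
      refine ⟨?_, ?_, par_fin a b t0 t1 p0 p1⟩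
      · refine ENNReal.div_ne_zero.2 ⟨?_, ?_⟩
        · exact fun h => p0 (by simpa using le_trans (le_max_left a b) h.le)
        · refine ENNReal.div_ne_top ?_ ?_ <;> simp [t0, t1]
      · refine ENNReal.div_ne_top ?_ ?_
        · rcases max_choice a b with h | h <;> rw [h] <;> assumption
        · simp [p0]
    · subst t1; simp [par_top_right]
    · subst t0; simp [par_top_left]
    · subst t0; subst t1; simp [par_top_left]

lemma CZ_step (d : ℕ) (h : Inv (2*d)) (x : Fin (2^(2*d+1+1)) → Bool) :
    CZ false (2*d+1+1) x =
      par (CZ false (2*d) (halfInput (2*d) false (halfInput (2*d+1) false x)))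
        (CZ false (2*d) (halfInput (2*d) true (halfInput (2*d+1) false x))) +
      par (CZ false (2*d) (halfInput (2*d) false (halfInput (2*d+1) true x)))
        (CZ false (2*d) (halfInput (2*d) true (halfInput (2*d+1) true x))) := by
  rw [CZ_even (2*d+1) (by omega)]
  obtain ⟨a0, b0, c0⟩ := crit_spec d h (halfInput (2*d+1) false x)
  obtain ⟨a1, b1, c1⟩ := crit_spec d h (halfInput (2*d+1) true x)
  rw [CZ_odd (2*d) (by omega) _ a0 b0, CZ_odd (2*d) (by omega) _ a1 b1, c0, c1, ← mul_add,
    mul_comm, mul_div_assoc, ENNReal.div_self (by simp) (by simp), mul_one]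

lemma par_ne_zero {a b : ℝ≥0∞} (ha : a ≠ 0) (hb : b ≠ 0) : par a b ≠ 0 := by
  simp [par, ha, hb]

lemma inv_all (d : ℕ) : Inv (2*d) := by
  induction d with
  | zero => exact inv_zero
  | succ d ih =>
    intro x
    change CZ false (2*d+1+1) x ≠ 0 ∧ (CZ false (2*d+1+1) x = ⊤ ↔ nand (2*d+1+1) x = true)
    rw [CZ_step d ih x]
    constructor
    · have := par_ne_zero (ih (halfInput (2*d) false (halfInput (2*d+1) false x))).1
        (ih (halfInput (2*d) true (halfInput (2*d+1) false x))).1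
      simp [this]
    · rw [ENNReal.add_eq_top, par_eq_top, par_eq_top, (ih _).2, (ih _).2, (ih _).2, (ih _).2]
      rw [nand, if_pos (by omega), nand, nand, if_neg (by omega), if_neg (by omega)]
      simp

/-! ### Series-parallel recursion -/

/-- resistance of the recursive network, expanded from the root -/
noncomputable def T : ℕ → (List Bool → ℝ≥0∞) → ℝ≥0∞
  | 0, w => w []
  | (d+1), w =>
    par (T d (fun s => w (false :: false :: s))) (T d (fun s => w (false :: true :: s))) +
    par (T d (fun s => w (true :: false :: s))) (T d (fun s => w (true :: true :: s)))

lemma T_congr (d : ℕ) (w w' : List Bool → ℝ≥0∞) (h : ∀ s, s.length = 2*d → w s = w' s) :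
    T d w = T d w' := by
  induction d generalizing w w' with
  | zero => exact h [] rfl
  | succ d ih =>
    simp only [T]
    congr 2 <;> refine ih _ _ fun s hs => h _ (by simp [hs]; ring)

/-- combine the four bottom edges -/
noncomputable def squash (w : List Bool → ℝ≥0∞) (s : List Bool) : ℝ≥0∞ :=
  par (w (s ++ [false, false])) (w (s ++ [false, true])) +
    par (w (s ++ [true, false])) (w (s ++ [true, true]))

lemma T_squash (d : ℕ) (w : List Bool → ℝ≥0∞) : T (d+1) w = T d (squash w) := by
  induction d generalizing w with
  | zero => rfl
  | succ d ih =>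
    rw [T, ih, ih, ih, ih]
    rfl

lemma CZ_eq_T (d : ℕ) (x : Fin (2^(2*d)) → Bool) :
    CZ false (2*d) x = T d (fun s => if leafVal (2*d) x s = false then 1 else ⊤) := by
  induction d with
  | zero =>
    have := CZ_zero x
    change CZ false 0 x = _
    rw [this]
    have e : leafVal (2*0) x [] = x ⟨0, by norm_num⟩ := by simp [leafVal, leafIdx]
    simp only [T, e]
    generalize x ⟨0, by norm_num⟩ = z
    cases z <;> simp
  | succ d ih =>
    change CZ false (2*d+1+1) x = _
    rw [CZ_step d (inv_all d), ih, ih, ih, ih, T]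
    congr 2 <;> refine T_congr _ _ _ fun s hs => ?_ <;>
      (change _ = if leafVal (2*d+1+1) x _ = false then 1 else ⊤
       rw [leafVal_cons _ _ _ _ (by simp [hs]), leafVal_cons _ _ _ _ hs])

/-! ### Flow side -/

/-- weighted energy minimum -/
noncomputable def WR (d : ℕ) (r : Edg' d → ℝ≥0∞) : ℝ≥0∞ :=
  ⨅ θ ∈ {θ : Edg' d → ℝ | IsUnitFlow (ep' d) (fun _ => True) (sVtx' d) (tVtx' d) θ},
    ∑ e, r e * ENNReal.ofReal ((θ e)^2)

lemma par_le (r q : ℝ≥0∞) (a b : ℝ) :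
    par r q * ENNReal.ofReal ((a+b)^2) ≤
      r * ENNReal.ofReal (a^2) + q * ENNReal.ofReal (b^2) := by
  rcases eq_or_ne r 0 with rfl | hr0
  · simp [par]
  rcases eq_or_ne q 0 with rfl | hq0
  · simp [par]
  rcases eq_or_ne r ⊤ with rfl | hr
  · rw [par_top_left]
    rcases eq_or_ne a 0 with rfl | ha
    · simp
    · have : ENNReal.ofReal (a^2) ≠ 0 := by
        have : 0 < a^2 := by positivity
        simpa using ha
      rw [ENNReal.top_mul this]
      simp
  rcases eq_or_ne q ⊤ with rfl | hq
  · rw [par_top_right]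
    rcases eq_or_ne b 0 with rfl | hb
    · simp
    · have : ENNReal.ofReal (b^2) ≠ 0 := by
        simpa using hb
      rw [ENNReal.top_mul this]
      simp
  have hr' := ENNReal.toReal_pos hr0 hr
  have hq' := ENNReal.toReal_pos hq0 hq
  rw [← ENNReal.ofReal_toReal hr, ← ENNReal.ofReal_toReal hq]
  generalize r.toReal = u at *
  generalize q.toReal = v at *
  unfold par
  rw [← ENNReal.ofReal_inv_of_pos hr', ← ENNReal.ofReal_inv_of_pos hq',
    ← ENNReal.ofReal_add (by positivity) (by positivity),
    ← ENNReal.ofReal_inv_of_pos (by positivity),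
    ← ENNReal.ofReal_mul (by positivity), ← ENNReal.ofReal_mul (by positivity),
    ← ENNReal.ofReal_mul (by positivity), ← ENNReal.ofReal_add (by positivity) (by positivity)]
  apply ENNReal.ofReal_le_ofReal
  rw [show (u⁻¹ + v⁻¹)⁻¹ = u * v / (u + v) by field_simp; ring]
  rw [div_mul_eq_mul_div, div_le_iff₀ (by positivity)]
  nlinarith [sq_nonneg (u*a - v*b)]

lemma par_split (r q : ℝ≥0∞) (t : ℝ) :
    ∃ a b : ℝ, a + b = t ∧ r * ENNReal.ofReal (a^2) + q * ENNReal.ofReal (b^2)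
      = par r q * ENNReal.ofReal (t^2) := by
  rcases eq_or_ne r 0 with rfl | hr0
  · exact ⟨t, 0, by simp, by simp [par]⟩
  rcases eq_or_ne q 0 with rfl | hq0
  · exact ⟨0, t, by simp, by simp [par]⟩
  rcases eq_or_ne r ⊤ with rfl | hr
  · exact ⟨0, t, by simp, by simp [par_top_left]⟩
  rcases eq_or_ne q ⊤ with rfl | hq
  · exact ⟨t, 0, by simp, by simp [par_top_right]⟩
  have hr' := ENNReal.toReal_pos hr0 hr
  have hq' := ENNReal.toReal_pos hq0 hq
  rw [← ENNReal.ofReal_toReal hr, ← ENNReal.ofReal_toReal hq]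
  generalize r.toReal = u at *
  generalize q.toReal = v at *
  refine ⟨t * v / (u+v), t * u / (u+v), by field_simp; ring, ?_⟩
  unfold par
  rw [← ENNReal.ofReal_inv_of_pos hr', ← ENNReal.ofReal_inv_of_pos hq',
    ← ENNReal.ofReal_add (by positivity) (by positivity),
    ← ENNReal.ofReal_inv_of_pos (by positivity),
    ← ENNReal.ofReal_mul (by positivity), ← ENNReal.ofReal_mul (by positivity),
    ← ENNReal.ofReal_mul (by positivity), ← ENNReal.ofReal_add (by positivity) (by positivity)]
  congr 1
  field_simp
  ring

/-- an edge of the next level -/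
def mkE {d : ℕ} (e : Edg' d) (c b : Bool) : Edg' (d+1) := (e, c, b)

/-- an old vertex -/
def inlV {d : ℕ} (v : Vtx' d) : Vtx' (d+1) := Sum.inl v

/-- a middle vertex -/
def inrV {d : ℕ} (e : Edg' d) : Vtx' (d+1) := Sum.inr e

lemma inlV_inj {d : ℕ} (v w : Vtx' d) : inlV v = inlV w ↔ v = w := Sum.inl_injective.eq_iff
lemma inrV_inj {d : ℕ} (v w : Edg' d) : inrV v = inrV w ↔ v = w := Sum.inr_injective.eq_iff
lemma inlV_ne {d : ℕ} (v : Vtx' d) (w : Edg' d) : (inlV v = inrV w) ↔ False :=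
  iff_of_false Sum.inl_ne_inr id
lemma inrV_ne {d : ℕ} (v : Vtx' d) (w : Edg' d) : (inrV w = inlV v) ↔ False :=
  iff_of_false Sum.inr_ne_inl id
lemma ep_ff {d : ℕ} (e : Edg' d) (b : Bool) :
    ep' (d+1) (mkE e false b) false = inlV (ep' d e false) := rfl
lemma ep_ft {d : ℕ} (e : Edg' d) (b : Bool) :
    ep' (d+1) (mkE e false b) true = inrV e := rfl
lemma ep_tf {d : ℕ} (e : Edg' d) (b : Bool) :
    ep' (d+1) (mkE e true b) false = inrV e := rfl
lemma ep_tt {d : ℕ} (e : Edg' d) (b : Bool) :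
    ep' (d+1) (mkE e true b) true = inlV (ep' d e true) := rfl
lemma sV_succ (d : ℕ) : sVtx' (d+1) = inlV (sVtx' d) := rfl
lemma tV_succ (d : ℕ) : tVtx' (d+1) = inlV (tVtx' d) := rfl

lemma sum_edg {M : Type} [AddCommMonoid M] (d : ℕ) (f : Edg' (d+1) → M) :
    ∑ e, f e = ∑ e : Edg' d, ((f (mkE e false false) + f (mkE e false true)) +
      (f (mkE e true false) + f (mkE e true true))) := by
  have h : ∀ g : Edg' d × Bool × Bool → M, ∑ p, g p = ∑ e : Edg' d,
      ((g (e, false, false) + g (e, false, true)) + (g (e, true, false) + g (e, true, true))) := by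
    intro g
    rw [Fintype.sum_prod_type]
    refine Finset.sum_congr rfl fun e _ => ?_
    rw [Fintype.sum_prod_type]
    simp only [Fintype.sum_bool]
    abel
  exact h f

lemma netFlow_inr (d : ℕ) (θ : Edg' (d+1) → ℝ) (e : Edg' d) :
    netFlow (ep' (d+1)) θ (inrV e) =
      (θ (mkE e true false) + θ (mkE e true true)) - (θ (mkE e false false) + θ (mkE e false true)) := by
  unfold netFlow
  rw [sum_edg, Finset.sum_eq_single e]
  · simp only [ep_ff, ep_ft, ep_tf, ep_tt, inlV_inj, inrV_inj, inlV_ne, inrV_ne, if_true, if_false]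
    ring
  · intro e' _ h
    simp only [ep_ff, ep_ft, ep_tf, ep_tt, inlV_inj, inrV_inj, inlV_ne, inrV_ne, h, if_false]
    ring
  · simp

lemma netFlow_inl (d : ℕ) (θ : Edg' (d+1) → ℝ) (v : Vtx' d)
    (h : ∀ e, θ (mkE e false false) + θ (mkE e false true) = θ (mkE e true false) + θ (mkE e true true)) :
    netFlow (ep' (d+1)) θ (inlV v) =
      netFlow (ep' d) (fun e => θ (mkE e false false) + θ (mkE e false true)) v := by
  unfold netFlow
  rw [sum_edg]
  refine Finset.sum_congr rfl fun e _ => ?_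
  have := h e
  simp only [ep_ff, ep_ft, ep_tf, ep_tt, inlV_inj, inrV_inj, inlV_ne, inrV_ne, if_false]
  by_cases h1 : ep' d e false = v <;> by_cases h2 : ep' d e true = v <;>
    simp only [h1, h2, if_true, if_false] <;> linarith

lemma flow_iff (d : ℕ) (θ : Edg' (d+1) → ℝ) :
    IsUnitFlow (ep' (d+1)) (fun _ => True) (sVtx' (d+1)) (tVtx' (d+1)) θ ↔
      (∀ e, θ (mkE e false false) + θ (mkE e false true) = θ (mkE e true false) + θ (mkE e true true)) ∧
      IsUnitFlow (ep' d) (fun _ => True) (sVtx' d) (tVtx' d)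
        (fun e => θ (mkE e false false) + θ (mkE e false true)) := by
  constructor
  · rintro ⟨_, h⟩
    have hm : ∀ e, θ (mkE e false false) + θ (mkE e false true)
        = θ (mkE e true false) + θ (mkE e true true) := by
      intro e
      have h1 := h (inrV e)
      rw [netFlow_inr] at h1
      rw [if_neg (by simp [sV_succ, inrV_ne]), if_neg (by simp [tV_succ, inrV_ne])] at h1
      linarith
    refine ⟨hm, by simp, fun v => ?_⟩
    rw [← netFlow_inl d θ v hm, h]
    simp only [sV_succ, tV_succ, inlV_inj]
    congr
  · rintro ⟨hm, _, h⟩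
    refine ⟨by simp, fun v => ?_⟩
    have hv : (∃ w, v = inlV w) ∨ (∃ e, v = inrV e) := by
      rcases v with v | e
      · exact Or.inl ⟨v, rfl⟩
      · exact Or.inr ⟨e, rfl⟩
    rcases hv with ⟨v, rfl⟩ | ⟨e, rfl⟩
    · rw [netFlow_inl d θ v hm, h]
      simp only [sV_succ, tV_succ, inlV_inj]
      congr
    · rw [netFlow_inr, ← hm e]
      rw [if_neg (by simp [sV_succ, inrV_ne]), if_neg (by simp [tV_succ, inrV_ne])]
      ring

/-- squash on edge weights -/
noncomputable def squashE (d : ℕ) (r : Edg' (d+1) → ℝ≥0∞) (e : Edg' d) : ℝ≥0∞ :=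
  par (r (mkE e false false)) (r (mkE e false true)) + par (r (mkE e true false)) (r (mkE e true true))

lemma WR_succ (d : ℕ) (r : Edg' (d+1) → ℝ≥0∞) : WR (d+1) r = WR d (squashE d r) := by
  apply le_antisymm
  · refine le_iInf₂ fun Θ hΘ => ?_
    choose a b hab hE using fun e : Edg' d =>
      par_split (r (mkE e false false)) (r (mkE e false true)) (Θ e)
    choose a' b' hab' hE' using fun e : Edg' d =>
      par_split (r (mkE e true false)) (r (mkE e true true)) (Θ e)
    let θ : Edg' d × Bool × Bool → ℝ := fun p =>
      if p.2.1 then (if p.2.2 then b' p.1 else a' p.1) else (if p.2.2 then b p.1 else a p.1)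
    refine (iInf₂_le (i := (θ : Edg' (d+1) → ℝ)) ?_).trans ?_
    · refine (flow_iff d θ).2 ⟨?_, ?_⟩
      · intro e
        simp [θ, mkE, hab, hab']
      · simpa [θ, mkE, hab] using hΘ
    · rw [sum_edg]
      refine le_of_eq (Finset.sum_congr rfl fun e _ => ?_)
      rw [squashE, add_mul, ← hE, ← hE']
      simp [θ, mkE]
  · refine le_iInf₂ fun θ hθ => ?_
    obtain ⟨hm, hf⟩ := (flow_iff d θ).1 hθ
    refine (iInf₂_le _ hf).trans ?_
    rw [sum_edg]
    refine Finset.sum_le_sum fun e _ => ?_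
    rw [squashE, add_mul]
    refine add_le_add (par_le _ _ _ _) ?_
    beta_reduce
    rw [hm]
    exact par_le _ _ _ _

lemma sum_edg_zero {M : Type} [AddCommMonoid M] (f : Edg' 0 → M) : ∑ e, f e = f () := by
  have h : ∀ g : Unit → M, ∑ e, g e = g () := by simp
  exact h f

lemma netFlow_zero (θ : Edg' 0 → ℝ) (v : Vtx' 0) : netFlow (ep' 0) θ v =
    θ () * ((if v = sVtx' 0 then 1 else 0) - (if v = tVtx' 0 then 1 else 0)) := by
  unfold netFlow
  rw [sum_edg_zero]
  have h1 : ep' 0 () false = sVtx' 0 := rfl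
  have h2 : ep' 0 () true = tVtx' 0 := rfl
  rw [h1, h2]
  simp only [eq_comm]

lemma st_zero : sVtx' 0 ≠ tVtx' 0 := Bool.false_ne_true

lemma WR_zero (r : Edg' 0 → ℝ≥0∞) : WR 0 r = r () := by
  apply le_antisymm
  · refine (iInf₂_le (i := fun _ => (1:ℝ)) ?_).trans ?_
    · refine ⟨by simp, fun v => ?_⟩
      rw [netFlow_zero, one_mul]
      congr
    · rw [sum_edg_zero]; simp
  · refine le_iInf₂ fun θ hθ => ?_
    have h := hθ.2 (sVtx' 0)
    rw [netFlow_zero] at h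
    rw [sum_edg_zero]
    have : θ () = 1 := by simpa [st_zero] using h
    simp [this]

lemma WR_eq_T (d : ℕ) (w : List Bool → ℝ≥0∞) : WR d (fun e => w (elabel' d e)) = T d w := by
  induction d generalizing w with
  | zero => rw [WR_zero]; rfl
  | succ d ih =>
    rw [WR_succ, T_squash, ← ih]
    rfl

lemma vtx_finite : (d : ℕ) → Finite (Vtx' d)
  | 0 => inferInstanceAs (Finite Bool)
  | (d+1) => by
    have := vtx_finite d
    exact inferInstanceAs (Finite (Vtx' d ⊕ Edg' d))

lemma connected_of_flow {V E : Type} [Fintype E] [Finite V] (epf : E → Bool → V)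
    (keep : E → Prop) (s t : V) (θ : E → ℝ) (h : IsUnitFlow epf keep s t θ) :
    ConnectedIn epf keep s t := by
  by_contra hc
  have := Fintype.ofFinite V
  let φ : V → ℝ := fun v => if ConnectedIn epf keep s v then 1 else 0
  have h1 : ∑ v, φ v * netFlow epf θ v = 1 := by
    simp only [h.2, mul_sub, Finset.sum_sub_distrib, mul_ite, mul_one, mul_zero,
      Finset.sum_ite_eq', Finset.mem_univ, if_true]
    have : ConnectedIn epf keep s s := Relation.ReflTransGen.refl
    simp [φ, hc, this]
  have h2 : ∑ v, φ v * netFlow epf θ v = ∑ e, θ e * (φ (epf e false) - φ (epf e true)) := by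
    simp only [netFlow, Finset.mul_sum]
    rw [Finset.sum_comm]
    refine Finset.sum_congr rfl fun e _ => ?_
    have : ∀ v, φ v * (θ e * ((if epf e false = v then (1:ℝ) else 0)
        - (if epf e true = v then 1 else 0))) =
        (if epf e false = v then θ e * φ v else 0) - (if epf e true = v then θ e * φ v else 0) := by
      intro v
      split_ifs <;> ring
    simp only [this, Finset.sum_sub_distrib, Finset.sum_ite_eq, Finset.mem_univ, if_true]
    ring
  have h3 : ∑ e, θ e * (φ (epf e false) - φ (epf e true)) = 0 := by
    refine Finset.sum_eq_zero fun e _ => ?_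
    by_cases hk : keep e
    · have : ConnectedIn epf keep s (epf e false) ↔ ConnectedIn epf keep s (epf e true) :=
        ⟨fun h => h.tail ⟨e, hk, Or.inl ⟨rfl, rfl⟩⟩, fun h => h.tail ⟨e, hk, Or.inr ⟨rfl, rfl⟩⟩⟩
      simp [φ, this]
    · rw [h.1 e hk, zero_mul]
  linarith

lemma effRes_eq_WR (d : ℕ) (keep : Edg' d → Prop) :
    effRes (ep' d) keep (sVtx' d) (tVtx' d) = WR d (fun e => if keep e then 1 else ⊤) := by
  have := vtx_finite d
  have h1 : effRes (ep' d) keep (sVtx' d) (tVtx' d) =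
      ⨅ θ ∈ {θ : Edg' d → ℝ | IsUnitFlow (ep' d) keep (sVtx' d) (tVtx' d) θ},
        ENNReal.ofReal (∑ e, (θ e)^2) := by
    unfold effRes
    split_ifs with hc
    · rfl
    · symm
      simp only [iInf_eq_top]
      intro θ hθ
      exact absurd (connected_of_flow _ _ _ _ θ hθ) hc
  have hen : ∀ θ : Edg' d → ℝ, (∀ e, ¬ keep e → θ e = 0) →
      ∑ e, (if keep e then 1 else ⊤) * ENNReal.ofReal ((θ e)^2) =
        ENNReal.ofReal (∑ e, (θ e)^2) := by
    intro θ h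
    rw [ENNReal.ofReal_sum_of_nonneg (fun _ _ => sq_nonneg _)]
    refine Finset.sum_congr rfl fun e _ => ?_
    by_cases hk : keep e
    · simp [hk]
    · simp [hk, h e hk]
  rw [h1]
  apply le_antisymm
  · refine le_iInf₂ fun θ hθ => ?_
    by_cases h : ∀ e, ¬ keep e → θ e = 0
    · rw [hen θ h]
      exact iInf₂_le θ ⟨h, hθ.2⟩
    · push Not at h
      obtain ⟨e, hk, he⟩ := h
      have : (⊤:ℝ≥0∞) ≤ ∑ e, (if keep e then 1 else ⊤) * ENNReal.ofReal ((θ e)^2) := by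
        refine le_trans ?_ (Finset.single_le_sum (fun _ _ => bot_le) (Finset.mem_univ e))
        rw [if_neg hk, ENNReal.top_mul (by simpa using he)]
      exact le_trans le_top this
  · refine le_iInf₂ fun θ hθ => ?_
    rw [← hen θ hθ.1]
    exact iInf₂_le θ ⟨by simp, hθ.2⟩

/-- `C_B(x) = R_{s',t'}(G'_d(x))`; in particular both sides are `∞`
exactly when `x` is a `1`-instance. -/
theorem CB_eq_effRes' (d : ℕ) (x : Fin (2^(2*d)) → Bool) :
    CZ false (2*d) x
      = effRes (ep' d) (fun e => edgeBit' d x e = false) (sVtx' d) (tVtx' d) ∧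
    (CZ false (2*d) x = ⊤ ↔ nand (2*d) x = true) := by
  refine ⟨?_, (inv_all d x).2⟩
  rw [effRes_eq_WR, CZ_eq_T, ← WR_eq_T]
  congr 1
  funext e
  unfold edgeBit'
  congr

end NandTree
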